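/- Let F : T → T' and G : T' → T be triangulated functors commuting with small direct sums between triangulated categories T and T' that are generated, as triangulated categories with small sums, by sets K and K' of compact objects respectively. Suppose that F(X) is compact for each X ∈ K, that there is an invertible natural transformation F ∘ G ≅ id, and that the induced maps Hom(X[n], GY) → Hom(FX[n], Y) are bijective for all n ∈ ℤ, X ∈ K, Y ∈ K'. Then F is a left adjoint to G. -/

import Mathlib

/-!
STATEMENT 11: An adjunction criterion for triangulated functors between compactly generated
triangulated categories (Vezzani, Proposition `redtocp`).
-/

open CategoryTheory Limits Pretriangulated

set_option autoImplicit false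

universe v u u'

noncomputable section

section Compactness

variable {C : Type u} [Category.{v} C] [Preadditive C]

/-- The canonical comparison map `⨁_j Hom(X, f j) → Hom(X, ∐ f)`. -/
def sumComparison (X : C) {J : Type v} [DecidableEq J] (f : J → C) [HasCoproduct f] :
    DirectSum J (fun j => X ⟶ f j) →+ (X ⟶ ∐ f) :=
  DirectSum.toAddMonoid fun j =>
    AddMonoidHom.mk' (fun g => g ≫ Sigma.ι f j) (fun a b => Preadditive.add_comp _ _ _ _ _ _)

/-- An object `X` is compact if `Hom(X, −)` commutes with small direct sums: the canonical map
`⨁_j Hom(X, f j) → Hom(X, ∐ f)` is bijective for every small family `f`. -/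
def IsCompactObj (X : C) : Prop :=
  ∀ (J : Type v) (f : J → C) (_ : HasCoproduct f),
    letI := Classical.decEq J
    Function.Bijective (sumComparison X f)

end Compactness

section Generation

variable (T : Type u) [Category.{v} T] [Preadditive T] [HasZeroObject T] [HasShift T ℤ]
  [∀ n : ℤ, (shiftFunctor T n).Additive] [Pretriangulated T]

/-- A set of objects `G` generates a triangulated category with small sums: every class of
objects containing `G` and closed under isomorphisms, shifts, cones of distinguished triangles
and small coproducts contains every object. -/
def GeneratesWithSums (G : Set T) : Prop :=
  ∀ P : Set T,
    (∀ X ∈ G, X ∈ P) →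
    (∀ X Y : T, X ∈ P → Nonempty (X ≅ Y) → Y ∈ P) →
    (∀ X ∈ P, ∀ n : ℤ, X⟦n⟧ ∈ P) →
    (∀ Tr : Triangle T, Tr ∈ (distinguishedTriangles (C := T)) →
      Tr.obj₁ ∈ P → Tr.obj₂ ∈ P → Tr.obj₃ ∈ P) →
    (∀ (J : Type v) (f : J → T) (_ : HasCoproduct f), (∀ j, f j ∈ P) → (∐ f) ∈ P) →
    ∀ X : T, X ∈ P

end Generation

section Helpers

/-- `F` induces a bijection `Hom(X, Z) → Hom(FX, FZ)`. -/
def FullyFaithfulAt {C : Type u} [Category.{v} C] {D : Type u'} [Category.{v} D]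
    (F : C ⥤ D) (X Z : C) : Prop :=
  Function.Bijective (fun φ : X ⟶ Z => F.map φ)

namespace FullyFaithfulAt

section Basic

variable {C : Type u} [Category.{v} C] {D : Type u'} [Category.{v} D] {F : C ⥤ D}

lemma congr {X X' Z Z' : C} (a : X ≅ X') (b : Z ≅ Z') (h : FullyFaithfulAt F X Z) :
    FullyFaithfulAt F X' Z' := by
  constructor
  · intro φ ψ hφ
    have hφ' : F.map φ = F.map ψ := hφ
    have : a.hom ≫ φ ≫ b.inv = a.hom ≫ ψ ≫ b.inv := by
      apply h.1
      simp [hφ']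
    simpa using this
  · intro g
    obtain ⟨φ, hφ⟩ := h.2 (F.map a.hom ≫ g ≫ F.map b.inv)
    refine ⟨a.inv ≫ φ ≫ b.hom, ?_⟩
    have hφ' : F.map φ = _ := hφ
    change F.map (a.inv ≫ φ ≫ b.hom) = g
    rw [F.map_comp, F.map_comp, hφ', Category.assoc, Category.assoc, ← F.map_comp, b.inv_hom_id,
      F.map_id, Category.comp_id, ← Category.assoc, ← F.map_comp, a.inv_hom_id, F.map_id,
      Category.id_comp]

lemma sigma {J : Type v} (f : J → C) [HasCoproduct f]
    [PreservesColimitsOfShape (Discrete J) F] {Z : C}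
    (h : ∀ j, FullyFaithfulAt F (f j) Z) : FullyFaithfulAt F (∐ f) Z := by
  constructor
  · intro φ ψ hφ
    have hφ' : F.map φ = F.map ψ := hφ
    refine Sigma.hom_ext _ _ fun j => (h j).1 ?_
    simp [hφ']
  · intro g
    choose φ hφ using fun j => (h j).2 (F.map (Sigma.ι f j) ≫ g)
    refine ⟨Sigma.desc φ, ?_⟩
    refine Cofan.IsColimit.hom_ext (isColimitOfHasCoproductOfPreservesColimit F f) _ _ fun j => ?_
    have := hφ j
    dsimp at this ⊢
    rw [← this, ← F.map_comp]
    simp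

end Basic

section Compact

variable {C : Type u} [Category.{v} C] [Preadditive C] {D : Type u'} [Category.{v} D]
  [Preadditive D] {F : C ⥤ D}

lemma sigma_right {J : Type v} (f : J → C) [HasCoproduct f]
    [HasCoproduct (fun j => F.obj (f j))] [F.Additive]
    [PreservesColimitsOfShape (Discrete J) F] {X : C}
    (hX : IsCompactObj X) (hFX : IsCompactObj (F.obj X))
    (h : ∀ j, FullyFaithfulAt F X (f j)) : FullyFaithfulAt F X (∐ f) := by
  letI := Classical.decEq J
  have h₁ : Function.Bijective (sumComparison X f) := hX J f inferInstance
  have h₂ : Function.Bijective (sumComparison (F.obj X) (fun j => F.obj (f j))) :=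
    hFX J _ inferInstance
  let m : ∀ j, (X ⟶ f j) →+ (F.obj X ⟶ F.obj (f j)) := fun j => F.mapAddHom
  have h₃ : Function.Bijective (DirectSum.map m) :=
    ⟨(DirectSum.map_injective m).2 fun j => (h j).1,
      (DirectSum.map_surjective m).2 fun j => (h j).2⟩
  have h₄ : Function.Bijective
      (fun g : (F.obj X ⟶ ∐ fun j => F.obj (f j)) => g ≫ sigmaComparison F f) := by
    constructor
    · intro a b hab
      exact (cancel_mono _).1 hab
    · intro g
      exact ⟨g ≫ inv (sigmaComparison F f), by simp⟩
  have key : ∀ x, F.map (sumComparison X f x) =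
      sumComparison (F.obj X) (fun j => F.obj (f j)) (DirectSum.map m x) ≫
        sigmaComparison F f := by
    intro x
    induction x using DirectSum.induction_on with
    | zero => simp
    | of j g => simp [sumComparison, m]
    | add x y hx hy => simp [hx, hy, F.map_add]
  have h₅ : Function.Bijective
      ((fun φ : X ⟶ ∐ f => F.map φ) ∘ (sumComparison X f)) := by
    have := h₄.comp (h₂.comp h₃)
    convert this using 1
    funext x
    exact key x
  exact (Function.Bijective.of_comp_iff _ h₁).1 h₅

end Compact

section Tri

variable {T : Type u} [Category.{v} T] [Preadditive T] [HasZeroObject T] [HasShift T ℤ]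
    [∀ n : ℤ, (shiftFunctor T n).Additive] [Pretriangulated T]
    {T' : Type u'} [Category.{v} T'] [Preadditive T'] [HasZeroObject T'] [HasShift T' ℤ]
    [∀ n : ℤ, (shiftFunctor T' n).Additive] [Pretriangulated T']
    {F : T ⥤ T'} [F.CommShift ℤ]

lemma shift {X Z : T} (h : FullyFaithfulAt F X Z) (n : ℤ) :
    FullyFaithfulAt F (X⟦n⟧) (Z⟦n⟧) := by
  have key : ∀ φ : X ⟶ Z, F.map (φ⟦n⟧') = (F.commShiftIso n).hom.app X ≫ (F.map φ)⟦n⟧' ≫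
      (F.commShiftIso n).inv.app Z := by
    intro φ
    simp
  constructor
  · intro φ ψ hφ
    obtain ⟨φ, rfl⟩ := (shiftFunctor T n).map_surjective φ
    obtain ⟨ψ, rfl⟩ := (shiftFunctor T n).map_surjective ψ
    have hφ' : F.map (φ⟦n⟧') = F.map (ψ⟦n⟧') := hφ
    rw [key, key, cancel_epi, cancel_mono] at hφ'
    rw [h.1 ((shiftFunctor T' n).map_injective hφ')]
  · intro g
    obtain ⟨g', hg'⟩ := (shiftFunctor T' n).map_surjective
      ((F.commShiftIso n).inv.app X ≫ g ≫ (F.commShiftIso n).hom.app Z)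
    obtain ⟨φ, hφ⟩ := h.2 g'
    have hφ' : F.map φ = g' := hφ
    refine ⟨φ⟦n⟧', ?_⟩
    change F.map (φ⟦n⟧') = g
    rw [key, hφ', hg']
    simp

lemma of_shift {X Z : T} (n : ℤ) (h : FullyFaithfulAt F (X⟦n⟧) (Z⟦n⟧)) :
    FullyFaithfulAt F X Z :=
  (h.shift (-n)).congr ((shiftFunctorCompIsoId T n (-n) (by simp)).app X)
    ((shiftFunctorCompIsoId T n (-n) (by simp)).app Z)

variable [F.IsTriangulated]

lemma eq_zero {X Z : T} (h : FullyFaithfulAt F X Z) {φ : X ⟶ Z} (hφ : F.map φ = 0) : φ = 0 :=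
  h.1 (by simpa using hφ)

lemma ex_coyoneda₂ (t : Triangle T) (ht : t ∈ distTriang T) {A : T'} (f : A ⟶ F.obj t.obj₂)
    (hf : f ≫ F.map t.mor₂ = 0) : ∃ g : A ⟶ F.obj t.obj₁, f = g ≫ F.map t.mor₁ :=
  (F.mapTriangle.obj t).coyoneda_exact₂ (F.map_distinguished t ht) f hf

lemma ex_coyoneda₃ (t : Triangle T) (ht : t ∈ distTriang T) {A : T'} (f : A ⟶ F.obj t.obj₃)
    (hf : f ≫ F.map t.mor₃ = 0) : ∃ g : A ⟶ F.obj t.obj₂, f = g ≫ F.map t.mor₂ := by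
  refine (F.mapTriangle.obj t).coyoneda_exact₃ (F.map_distinguished t ht) f ?_
  change f ≫ F.map t.mor₃ ≫ (F.commShiftIso (1 : ℤ)).hom.app t.obj₁ = 0
  rw [← Category.assoc, hf, zero_comp]

lemma ex_yoneda₃ (t : Triangle T) (ht : t ∈ distTriang T) {A : T'} (f : F.obj t.obj₃ ⟶ A)
    (hf : F.map t.mor₂ ≫ f = 0) :
    ∃ g : F.obj (t.obj₁⟦(1 : ℤ)⟧) ⟶ A, f = F.map t.mor₃ ≫ g := by
  obtain ⟨g, hg⟩ : ∃ g : (F ⋙ shiftFunctor T' (1 : ℤ)).obj t.obj₁ ⟶ A,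
      f = (F.map t.mor₃ ≫ (F.commShiftIso (1 : ℤ)).hom.app t.obj₁) ≫ g :=
    (F.mapTriangle.obj t).yoneda_exact₃ (F.map_distinguished t ht) f hf
  exact ⟨(F.commShiftIso (1 : ℤ)).hom.app t.obj₁ ≫ g, by rw [hg, Category.assoc]⟩

lemma cone_right {X : T} (t : Triangle T) (ht : t ∈ distTriang T)
    (h₁ : FullyFaithfulAt F X t.obj₁) (h₂ : FullyFaithfulAt F X t.obj₂)
    (h₁' : FullyFaithfulAt F X (t.obj₁⟦(1 : ℤ)⟧)) (h₂' : FullyFaithfulAt F X (t.obj₂⟦(1 : ℤ)⟧)) :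
    FullyFaithfulAt F X t.obj₃ := by
  have inj : ∀ φ : X ⟶ t.obj₃, F.map φ = 0 → φ = 0 := by
    intro φ hφ
    have h0 : φ ≫ t.mor₃ = 0 := h₁'.eq_zero (by simp [hφ])
    obtain ⟨ψ, rfl⟩ := t.coyoneda_exact₃ ht φ h0
    obtain ⟨χ, hχ⟩ := ex_coyoneda₂ t ht (F.map ψ) (by simpa using hφ)
    obtain ⟨χ, rfl⟩ := h₁.2 χ
    have : ψ = χ ≫ t.mor₁ := h₂.1 (by simpa using hχ)
    rw [this, Category.assoc, comp_distTriang_mor_zero₁₂ _ ht, comp_zero]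
  constructor
  · intro φ ψ hφ
    have hφ' : F.map φ = F.map ψ := hφ
    rw [← sub_eq_zero]
    apply inj
    rw [F.map_sub, hφ', sub_self]
  · intro g
    obtain ⟨α, hα⟩ := h₁'.2 (g ≫ F.map t.mor₃)
    have hα : F.map α = g ≫ F.map t.mor₃ := hα
    obtain ⟨β, rfl⟩ := t.coyoneda_exact₁ ht α (h₂'.eq_zero (by
      rw [F.map_comp, hα, Category.assoc, ← F.map_comp, comp_distTriang_mor_zero₃₁ _ ht,
        F.map_zero, comp_zero]))
    obtain ⟨γ, hγ⟩ := ex_coyoneda₃ t ht (g - F.map β) (by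
      have : F.map β ≫ F.map t.mor₃ = g ≫ F.map t.mor₃ := by rw [← hα, F.map_comp]
      rw [Preadditive.sub_comp, this, sub_self])
    obtain ⟨γ, rfl⟩ := h₂.2 γ
    refine ⟨β + γ ≫ t.mor₂, ?_⟩
    have hγ' : g - F.map β = F.map γ ≫ F.map t.mor₂ := hγ
    change F.map _ = g
    rw [F.map_add, F.map_comp, ← hγ', add_sub_cancel]

lemma cone_left {Z : T} (t : Triangle T) (ht : t ∈ distTriang T)
    (h₁ : FullyFaithfulAt F t.obj₁ Z) (h₂ : FullyFaithfulAt F t.obj₂ Z)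
    (h₁' : FullyFaithfulAt F (t.obj₁⟦(1 : ℤ)⟧) Z) (h₂' : FullyFaithfulAt F (t.obj₂⟦(1 : ℤ)⟧) Z) :
    FullyFaithfulAt F t.obj₃ Z := by
  have inj : ∀ φ : t.obj₃ ⟶ Z, F.map φ = 0 → φ = 0 := by
    intro φ hφ
    have h0 : t.mor₂ ≫ φ = 0 := h₂.eq_zero (by simp [hφ])
    obtain ⟨ψ, rfl⟩ := t.yoneda_exact₃ ht φ h0
    obtain ⟨χ, hχ⟩ : ∃ χ : F.obj (t.obj₂⟦(1 : ℤ)⟧) ⟶ F.obj Z,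
        F.map ψ = F.map (-t.mor₁⟦(1 : ℤ)⟧') ≫ χ :=
      ex_yoneda₃ t.rotate (rot_of_distTriang _ ht) (F.map ψ)
        (show F.map t.mor₃ ≫ F.map ψ = 0 by rw [← F.map_comp, hφ])
    obtain ⟨χ', rfl⟩ := h₂'.2 χ
    have : ψ = (-t.mor₁⟦(1 : ℤ)⟧') ≫ χ' := h₁'.1 (by
      change F.map _ = F.map _
      rw [F.map_comp, hχ])
    rw [this, Preadditive.neg_comp, Preadditive.comp_neg, ← Category.assoc,
      comp_distTriang_mor_zero₃₁ _ ht, zero_comp, neg_zero]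
  constructor
  · intro φ ψ hφ
    have hφ' : F.map φ = F.map ψ := hφ
    rw [← sub_eq_zero]
    apply inj
    rw [F.map_sub, hφ', sub_self]
  · intro g
    obtain ⟨α, hα⟩ := h₂.2 (F.map t.mor₂ ≫ g)
    have hα : F.map α = F.map t.mor₂ ≫ g := hα
    obtain ⟨β, rfl⟩ := t.yoneda_exact₂ ht α (h₁.eq_zero (by
      rw [F.map_comp, hα, ← Category.assoc, ← F.map_comp, comp_distTriang_mor_zero₁₂ _ ht,
        F.map_zero, zero_comp]))
    obtain ⟨γ, hγ⟩ := ex_yoneda₃ t ht (g - F.map β) (by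
      change F.map t.mor₂ ≫ (g - F.map β) = 0
      rw [Preadditive.comp_sub, ← hα, F.map_comp, sub_self])
    obtain ⟨γ', rfl⟩ := h₁'.2 γ
    have hγ : g - F.map β = F.map t.mor₃ ≫ F.map γ' := hγ
    refine ⟨β + t.mor₃ ≫ γ', ?_⟩
    change F.map _ = g
    rw [F.map_add, F.map_comp, ← hγ, add_sub_cancel]

end Tri

end FullyFaithfulAt

end Helpers


/-- **Proposition (redtocp)**.  Let `F : T → T'` and `G : T' → T` be triangulated functors
commuting with small direct sums between triangulated categories generated, as triangulated
categories with small sums, by sets `K` and `K'` of compact objects.  Suppose `F X` is compact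
for `X ∈ K`, that there is an invertible natural transformation `e : F ∘ G ≅ id`, and that the
induced maps `Hom(X[n], G Y) → Hom(F X[n], Y)`, `φ ↦ F φ ≫ e_Y`, are bijective for all `n ∈ ℤ`,
`X ∈ K`, `Y ∈ K'`.  Then `F` is a left adjoint to `G` (with counit `e`). -/
theorem left_adjoint_of_compact_generators
    {T : Type u} [Category.{v} T] [Preadditive T] [HasZeroObject T] [HasShift T ℤ]
    [∀ n : ℤ, (shiftFunctor T n).Additive] [Pretriangulated T] [HasCoproducts.{v} T]
    {T' : Type u'} [Category.{v} T'] [Preadditive T'] [HasZeroObject T'] [HasShift T' ℤ]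
    [∀ n : ℤ, (shiftFunctor T' n).Additive] [Pretriangulated T'] [HasCoproducts.{v} T']
    (F : T ⥤ T') (G : T' ⥤ T)
    [F.CommShift ℤ] [F.IsTriangulated] [G.CommShift ℤ] [G.IsTriangulated]
    -- `F` and `G` commute with small direct sums
    (hFsum : ∀ J : Type v, PreservesColimitsOfShape (Discrete J) F)
    (hGsum : ∀ J : Type v, PreservesColimitsOfShape (Discrete J) G)
    -- compact generators
    (K : Set T) (K' : Set T')
    (hKcp : ∀ X ∈ K, IsCompactObj X) (hK'cp : ∀ Y ∈ K', IsCompactObj Y)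
    (hKgen : GeneratesWithSums T K) (hK'gen : GeneratesWithSums T' K')
    -- `F` sends the chosen compact generators to compact objects
    (hFcp : ∀ X ∈ K, IsCompactObj (F.obj X))
    -- an invertible natural transformation `F ∘ G ≅ id`
    (e : G ⋙ F ≅ 𝟭 T')
    -- bijectivity of the induced maps on generators
    (hbij : ∀ (n : ℤ) (X : T), X ∈ K → ∀ Y ∈ K',
      Function.Bijective (fun φ : (X⟦n⟧ ⟶ G.obj Y) => F.map φ ≫ e.hom.app Y)) :
    ∃ adj : F ⊣ G, adj.counit = e.hom := by
  -- bijectivity of the induced map is bijectivity of `F` on morphisms, as `e` is invertible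
  have hiff : ∀ (X : T) (Y : T'), Function.Bijective
      (fun φ : (X ⟶ G.obj Y) => F.map φ ≫ e.hom.app Y) ↔ FullyFaithfulAt F X (G.obj Y) := by
    intro X Y
    have hb : Function.Bijective
        (fun g : (F.obj X ⟶ F.obj (G.obj Y)) => g ≫ e.hom.app Y) := by
      constructor
      · intro a b hab
        exact (cancel_mono (e.hom.app Y)).1 hab
      · intro g
        exact ⟨g ≫ e.inv.app Y, by simp⟩
    exact Function.Bijective.of_comp_iff' hb (fun φ : (X ⟶ G.obj Y) => F.map φ)
  -- first step: generators in the first variable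
  have step₁ : ∀ X ∈ K, ∀ (Y : T') (n : ℤ), FullyFaithfulAt F X ((G.obj Y)⟦n⟧) := by
    intro X hX
    refine hK'gen {Y | ∀ n : ℤ, FullyFaithfulAt F X ((G.obj Y)⟦n⟧)} ?_ ?_ ?_ ?_ ?_
    · intro Y hY n
      exact (((hiff _ _).1 (hbij (-n) X hX Y hY)).shift n).congr
        ((shiftFunctorCompIsoId T (-n) n (by simp)).app X) (Iso.refl _)
    · rintro Y Y' hY ⟨i⟩ n
      exact (hY n).congr (Iso.refl _) ((shiftFunctor T n).mapIso (G.mapIso i))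
    · intro Y hY m n
      exact (hY (m + n)).congr (Iso.refl _) ((shiftFunctorAdd T m n).app _ ≪≫
        (shiftFunctor T n).mapIso ((G.commShiftIso m).symm.app Y))
    · intro t ht h₁ h₂ n
      have ht' := Triangle.shift_distinguished _ (G.map_distinguished t ht) n
      exact FullyFaithfulAt.cone_right _ ht' (h₁ n) (h₂ n)
        ((h₁ (n + 1)).congr (Iso.refl _) ((shiftFunctorAdd T n 1).app _))
        ((h₂ (n + 1)).congr (Iso.refl _) ((shiftFunctorAdd T n 1).app _))
    · intro J f _ hf n
      have := hFsum J
      have := hGsum J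
      exact (FullyFaithfulAt.sigma_right (fun j => (G ⋙ shiftFunctor T n).obj (f j))
        (hKcp X hX) (hFcp X hX) (fun j => hf j n)).congr (Iso.refl _)
        (PreservesCoproduct.iso (G ⋙ shiftFunctor T n) f).symm
  -- second step
  have step₂ : ∀ (X : T) (Y : T'), FullyFaithfulAt F X (G.obj Y) := by
    have hsh : ∀ X : T, (∀ Y : T', FullyFaithfulAt F X (G.obj Y)) →
        ∀ (n : ℤ) (Y : T'), FullyFaithfulAt F (X⟦n⟧) (G.obj Y) := by
      intro X hX n Y
      exact ((hX (Y⟦-n⟧)).shift n).congr (Iso.refl _)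
        ((G.commShiftIso n).symm.app _ ≪≫
          G.mapIso ((shiftFunctorCompIsoId T' (-n) n (by simp)).app Y))
    refine hKgen {X | ∀ Y : T', FullyFaithfulAt F X (G.obj Y)} ?_ ?_ ?_ ?_ ?_
    · intro X hX Y
      exact (step₁ X hX Y 0).congr (Iso.refl _) ((shiftFunctorZero T ℤ).app _)
    · rintro X X' hX ⟨i⟩ Y
      exact (hX Y).congr i (Iso.refl _)
    · intro X hX n Y
      exact hsh X hX n Y
    · intro t ht h₁ h₂ Y
      exact FullyFaithfulAt.cone_left t ht (h₁ Y) (h₂ Y) (hsh _ h₁ 1 Y) (hsh _ h₂ 1 Y)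
    · intro J f _ hf Y
      have := hFsum J
      exact FullyFaithfulAt.sigma f (fun j => hf j Y)
  let E : ∀ (X : T) (Y : T'), (X ⟶ G.obj Y) ≃ (F.obj X ⟶ Y) := fun X Y =>
    Equiv.ofBijective _ ((hiff X Y).2 (step₂ X Y))
  have hE : ∀ (X : T) (Y : T') (φ : X ⟶ G.obj Y), E X Y φ = F.map φ ≫ e.hom.app Y :=
    fun X Y φ => rfl
  refine ⟨Adjunction.mkOfHomEquiv
    { homEquiv := fun X Y => (E X Y).symm
      homEquiv_naturality_left_symm := ?_
      homEquiv_naturality_right := ?_ }, ?_⟩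
  · intro X' X Y f g
    simp [hE]
  · intro X Y Y' f g
    rw [Equiv.symm_apply_eq, hE, F.map_comp, Category.assoc]
    have h1 := e.hom.naturality g
    dsimp at h1
    rw [h1, ← Category.assoc, ← hE, Equiv.apply_symm_apply]
  · ext Y
    simp [hE]

end
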